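/- arXiv:2604.20894 — 3 statements merged into one kernel-verified Lean document; each statement's English description precedes it below -/
import Mathlib

section
/- Let f : (X,r) → (U,s) be an i-homomorphism of non-degenerate solutions with i-kernel X₀ ⊆ X, and let f̄ : G_X → G_U be the induced skew brace homomorphism. Then the product I := ⟨ι(X₀)⟩_· · Ker f̄ (product of subsets in the multiplicative group of G_X, where ⟨ι(X₀)⟩_· is the multiplicative subgroup generated by ι(X₀)) equals ⟨ι(X₀)⟩_+ + Ker f̄, and I is an ideal of G_X. -/
/-!
Common definitions: skew braces, set-theoretic solutions of the Yang–Baxter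
equation, structure skew braces, ideals, i-homomorphisms, solubility.
-/

universe u v

/-- A skew (left) brace: two group structures `(B,+)` and `(B,·)` sharing the
same identity `0`, with `a·(b+c) = a·b − a + a·c`. -/
structure SkewBrace (B : Type u) where
  add : B → B → B
  zero : B
  neg : B → B
  mul : B → B → B
  inv : B → B
  add_assoc : ∀ a b c, add (add a b) c = add a (add b c)
  zero_add : ∀ a, add zero a = a
  add_zero : ∀ a, add a zero = a
  neg_add : ∀ a, add (neg a) a = zero
  add_neg : ∀ a, add a (neg a) = zero
  mul_assoc : ∀ a b c, mul (mul a b) c = mul a (mul b c)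
  zero_mul : ∀ a, mul zero a = a
  mul_zero : ∀ a, mul a zero = a
  inv_mul : ∀ a, mul (inv a) a = zero
  mul_inv : ∀ a, mul a (inv a) = zero
  compat : ∀ a b c, mul a (add b c) = add (add (mul a b) (neg a)) (mul a c)

namespace SkewBrace

variable {B : Type u} (S : SkewBrace B)

/-- `λ_a(b) = −a + a·b`. -/
def lam (a b : B) : B := S.add (S.neg a) (S.mul a b)

/-- `ρ_b(a) = λ_a(b)⁻¹ · a · b`. -/
def rho (b a : B) : B := S.mul (S.mul (S.inv (S.lam a b)) a) b

/-- The solution of the YBE associated with a skew brace: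
`r_B(a,b) = (λ_a(b), ρ_b(a))`. -/
def rB : B × B → B × B := fun p => (S.lam p.1 p.2, S.rho p.2 p.1)

end SkewBrace

/-- Homomorphism of skew braces: preserves both operations. -/
def IsHom {B : Type u} {C : Type v} (S : SkewBrace B) (T : SkewBrace C) (f : B → C) : Prop :=
  (∀ a b, f (S.add a b) = T.add (f a) (f b)) ∧ (∀ a b, f (S.mul a b) = T.mul (f a) (f b))

/-- The kernel of a skew brace homomorphism: preimage of `0`. -/
def brKer {B : Type u} {C : Type v} (T : SkewBrace C) (f : B → C) : Set B :=
  {a | f a = T.zero}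

/-- An ideal of a skew brace: a sub-skew brace, normal in both `(B,+)` and `(B,·)`,
and `λ_b`-invariant for all `b`. -/
def IsIdeal {B : Type u} (S : SkewBrace B) (I : Set B) : Prop :=
  S.zero ∈ I ∧
  (∀ a ∈ I, ∀ b ∈ I, S.add a b ∈ I) ∧ (∀ a ∈ I, S.neg a ∈ I) ∧
  (∀ a ∈ I, ∀ b ∈ I, S.mul a b ∈ I) ∧ (∀ a ∈ I, S.inv a ∈ I) ∧
  (∀ b : B, ∀ a ∈ I, S.add (S.add b a) (S.neg b) ∈ I) ∧
  (∀ b : B, ∀ a ∈ I, S.mul (S.mul b a) (S.inv b) ∈ I) ∧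
  (∀ b : B, S.lam b '' I = I)

/-- A skew brace is simple if it is non-trivial and its only ideals are `{0}` and `B`. -/
def IsSimpleBrace {B : Type u} (S : SkewBrace B) : Prop :=
  (∃ a : B, a ≠ S.zero) ∧
  ∀ I : Set B, IsIdeal S I → I = {S.zero} ∨ I = Set.univ

/-- The socle of a skew brace: elements `a` with `λ_a = id` commuting additively
with everything. -/
def Soc {B : Type u} (S : SkewBrace B) : Set B :=
  {a | (∀ b, S.lam a b = b) ∧ (∀ b, S.add a b = S.add b a)}

/-- `r × id` on triples. -/
def rOne {X : Type u} (r : X × X → X × X) : X × X × X → X × X × X :=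
  fun p => ((r (p.1, p.2.1)).1, (r (p.1, p.2.1)).2, p.2.2)

/-- `id × r` on triples. -/
def rTwo {X : Type u} (r : X × X → X × X) : X × X × X → X × X × X :=
  fun p => (p.1, r p.2)

/-- `(X,r)` is a set-theoretic solution of the Yang–Baxter equation. -/
def IsSolution {X : Type u} (r : X × X → X × X) : Prop :=
  Function.Bijective r ∧
  rOne r ∘ rTwo r ∘ rOne r = rTwo r ∘ rOne r ∘ rTwo r

/-- `λ_x(y)` for a solution, i.e. the first component of `r(x,y)`. -/
def lamMap {X : Type u} (r : X × X → X × X) (x : X) : X → X := fun y => (r (x, y)).1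

/-- `ρ_y(x)` for a solution, i.e. the second component of `r(x,y)`. -/
def rhoMap {X : Type u} (r : X × X → X × X) (y : X) : X → X := fun x => (r (x, y)).2

/-- Non-degeneracy: all `λ_x` and `ρ_y` are bijective. -/
def Nondeg {X : Type u} (r : X × X → X × X) : Prop :=
  (∀ x, Function.Bijective (lamMap r x)) ∧ (∀ y, Function.Bijective (rhoMap r y))

/-- Homomorphism of solutions: `(f×f)∘r = s∘(f×f)`. -/
def IsSolHom {X : Type u} {Y : Type v} (r : X × X → X × X) (s : Y × Y → Y × Y)
    (f : X → Y) : Prop :=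
  Prod.map f f ∘ r = s ∘ Prod.map f f

/-- The structure skew brace `(G_X, ι)` of a solution `(X,r)`: the image of `ι`
generates `(G_X,·)`, `ι` intertwines `r` with `r_{G_X}`, and the pair has the
universal property for maps into skew braces. -/
structure StructureBrace {X : Type u} (r : X × X → X × X) where
  G : Type u
  S : SkewBrace G
  ι : X → G
  gen : ∀ H : Set G, S.zero ∈ H → (∀ a ∈ H, ∀ b ∈ H, S.mul a b ∈ H) →
      (∀ a ∈ H, S.inv a ∈ H) → Set.range ι ⊆ H → H = Set.univ
  compat : Prod.map ι ι ∘ r = S.rB ∘ Prod.map ι ι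
  univ : ∀ {C : Type u} (T : SkewBrace C) (g : X → C),
      Prod.map g g ∘ r = T.rB ∘ Prod.map g g →
      ∃! h : G → C, IsHom S T h ∧ h ∘ ι = g

/-- The multiplicative subgroup (as a set) generated by a subset. -/
def mulClosure {B : Type u} (S : SkewBrace B) (A : Set B) : Set B :=
  ⋂₀ {H : Set B | S.zero ∈ H ∧ (∀ a ∈ H, ∀ b ∈ H, S.mul a b ∈ H) ∧
      (∀ a ∈ H, S.inv a ∈ H) ∧ A ⊆ H}

/-- The additive subgroup (as a set) generated by a subset. -/
def addClosure {B : Type u} (S : SkewBrace B) (A : Set B) : Set B :=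
  ⋂₀ {H : Set B | S.zero ∈ H ∧ (∀ a ∈ H, ∀ b ∈ H, S.add a b ∈ H) ∧
      (∀ a ∈ H, S.neg a ∈ H) ∧ A ⊆ H}

/-- The ideal generated by a subset: intersection of all ideals containing it. -/
def idealClosure {B : Type u} (S : SkewBrace B) (A : Set B) : Set B :=
  ⋂₀ {I : Set B | IsIdeal S I ∧ A ⊆ I}

/-- Product of two subsets in the multiplicative group. -/
def setMul {B : Type u} (S : SkewBrace B) (A₁ A₂ : Set B) : Set B :=
  {c | ∃ a ∈ A₁, ∃ b ∈ A₂, c = S.mul a b}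

/-- Sum of two subsets in the additive group. -/
def setAdd {B : Type u} (S : SkewBrace B) (A₁ A₂ : Set B) : Set B :=
  {c | ∃ a ∈ A₁, ∃ b ∈ A₂, c = S.add a b}

/-- The multiplicative left coset `a·I`. -/
def lCoset {B : Type u} (S : SkewBrace B) (a : B) (I : Set B) : Set B :=
  (fun w => S.mul a w) '' I

/-- Equivalence class of the kernel relation of a map. -/
def kerClass {X : Type u} {Y : Type v} (f : X → Y) (x : X) : Set X := {z | f z = f x}

/-- `X₀` is an i-kernel of the homomorphism of solutions `f : (X,r) → (Y,s)`:
`f` is a homomorphism of solutions, `X₀` is an equivalence class of `ker f`, and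
for every class `Z` of `ker f`, `r(X₀ × Z) = Z × X₀` and `r(Z × X₀) = X₀ × Z`.
A homomorphism admitting such a class is an i-homomorphism. -/
def IsIKernel {X : Type u} {Y : Type v} (r : X × X → X × X) (s : Y × Y → Y × Y)
    (f : X → Y) (X₀ : Set X) : Prop :=
  IsSolHom r s f ∧ (∃ x : X, X₀ = kerClass f x) ∧
  ∀ z : X, r '' (X₀ ×ˢ kerClass f z) = (kerClass f z) ×ˢ X₀ ∧
           r '' ((kerClass f z) ×ˢ X₀) = X₀ ×ˢ (kerClass f z)

/-- A strong left ideal: a `λ`-invariant subgroup of `(B,+)` which is normal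
in `(B,+)`. -/
def IsStrongLeftIdeal {B : Type u} (S : SkewBrace B) (I : Set B) : Prop :=
  S.zero ∈ I ∧ (∀ a ∈ I, ∀ b ∈ I, S.add a b ∈ I) ∧ (∀ a ∈ I, S.neg a ∈ I) ∧
  (∀ b : B, S.lam b '' I = I) ∧
  (∀ b : B, ∀ a ∈ I, S.add (S.add b a) (S.neg b) ∈ I)

/-- An abelian ideal: an ideal on which the two operations coincide and are
commutative (so it is an abelian/trivial skew brace). -/
def IsAbelianIdeal {C : Type u} (T : SkewBrace C) (J : Set C) : Prop :=
  IsIdeal T J ∧ ∀ a ∈ J, ∀ b ∈ J, T.mul a b = T.add a b ∧ T.add a b = T.add b a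

/-- Solubility of a skew brace: epimorphisms `f_k : B → B_k`, `0 ≤ k ≤ t`, with
`Ker f_t = 0 ⊆ … ⊆ Ker f_0 = B` and `f_k(Ker f_{k−1})` an abelian ideal of `B_k`. -/
def IsSoluble {B : Type u} (S : SkewBrace B) : Prop :=
  ∃ (t : ℕ) (C : Fin (t + 1) → Type u) (T : ∀ k, SkewBrace (C k)) (f : ∀ k, B → C k),
    (∀ k, IsHom S (T k) (f k) ∧ Function.Surjective (f k)) ∧
    brKer (T (Fin.last t)) (f (Fin.last t)) = {S.zero} ∧
    brKer (T 0) (f 0) = Set.univ ∧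
    (∀ k : Fin t, brKer (T k.succ) (f k.succ) ⊆ brKer (T k.castSucc) (f k.castSucc)) ∧
    (∀ k : Fin t, IsAbelianIdeal (T k.succ) (f k.succ '' brKer (T k.castSucc) (f k.castSucc)))

/-- Solubility of a solution `(X,r)` (with structure skew brace `(G_X, ι)`):
there are skew braces `B_0,…,B_t`, i-epimorphisms `f_k : (X,r) → (B_k, r_{B_k})`
with i-kernels `X_k` for `0 ≤ k ≤ t−1`, and an epimorphism `f_t`, such that
`ker f_k ⊆ ker f_{k−1}`, `ker f_0` is total, `ker f_t ⊆ ker ι`, and each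
`f_k(X_{k−1})` lies in an abelian ideal `J` of `B_k` with `f_k(x)·J = f_k(y)·J`
whenever `x (ker f_{k−1}) y`. -/
def IsSolubleSolution {X : Type u} (r : X × X → X × X) (GX : StructureBrace r) : Prop :=
  ∃ (t : ℕ) (C : Fin (t + 1) → Type u) (T : ∀ k, SkewBrace (C k))
    (f : ∀ k : Fin (t + 1), X → C k) (Xk : Fin t → Set X),
    (∀ k : Fin (t + 1), IsSolHom r (T k).rB (f k) ∧ Function.Surjective (f k)) ∧
    (∀ k : Fin t, IsIKernel r (T k.castSucc).rB (f k.castSucc) (Xk k)) ∧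
    (∀ x y : X, f 0 x = f 0 y) ∧
    (∀ k : Fin t, ∀ x y : X, f k.succ x = f k.succ y → f k.castSucc x = f k.castSucc y) ∧
    (∀ x y : X, f (Fin.last t) x = f (Fin.last t) y → GX.ι x = GX.ι y) ∧
    (∀ k : Fin t, ∃ J : Set (C k.succ), IsAbelianIdeal (T k.succ) J ∧
      f k.succ '' (Xk k) ⊆ J ∧
      ∀ x y : X, f k.castSucc x = f k.castSucc y →
        lCoset (T k.succ) (f k.succ x) J = lCoset (T k.succ) (f k.succ y) J)

/-- Decomposability of a solution: `X = Y ∪ Z` with `Y, Z` proper and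
`r(Y×Y) = Y×Y`, `r(Z×Z) = Z×Z`. -/
def Decomposable {X : Type u} (r : X × X → X × X) : Prop :=
  ∃ Y Z : Set X, Y ≠ Set.univ ∧ Z ≠ Set.univ ∧ Y ∪ Z = Set.univ ∧
    r '' (Y ×ˢ Y) = Y ×ˢ Y ∧ r '' (Z ×ˢ Z) = Z ×ˢ Z

namespace SkewBrace

variable {B : Type u} (S : SkewBrace B)

/-- The multiplicative group of a skew brace. -/
@[reducible] def mulGroup : Group B where
  mul := S.mul
  one := S.zero
  inv := S.inv
  mul_assoc := S.mul_assoc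
  one_mul := S.zero_mul
  mul_one := S.mul_zero
  inv_mul_cancel := S.inv_mul

/-- The additive group of a skew brace. -/
@[reducible] def addGroup : AddGroup B where
  add := S.add
  zero := S.zero
  neg := S.neg
  nsmul := @nsmulRec B ⟨S.zero⟩ ⟨S.add⟩
  zsmul := @zsmulRec B ⟨S.zero⟩ ⟨S.add⟩ ⟨S.neg⟩ (@nsmulRec B ⟨S.zero⟩ ⟨S.add⟩)
  add_assoc := S.add_assoc
  zero_add := S.zero_add
  add_zero := S.add_zero
  neg_add_cancel := S.neg_add

theorem mul_eq_add_lam (a b : B) : S.mul a b = S.add a (S.lam a b) := by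
  rw [lam, ← S.add_assoc, S.add_neg, S.zero_add]

theorem lam_add (a b c : B) : S.lam a (S.add b c) = S.add (S.lam a b) (S.lam a c) := by
  simp only [lam, S.compat, S.add_assoc]

theorem add_left_cancel {a b c : B} (h : S.add a b = S.add a c) : b = c := by
  rw [← S.zero_add b, ← S.zero_add c, ← S.neg_add a, S.add_assoc, S.add_assoc, h]

theorem lam_mul (a b c : B) : S.lam (S.mul a b) c = S.lam a (S.lam b c) := by
  apply S.add_left_cancel (a := S.mul a b)
  rw [← mul_eq_add_lam, S.mul_assoc, S.mul_eq_add_lam b c, S.mul_eq_add_lam a, lam_add,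
    ← S.add_assoc, ← mul_eq_add_lam]

theorem lam_zero_left (b : B) : S.lam S.zero b = b := by
  rw [← S.zero_add (S.lam _ _), ← mul_eq_add_lam, S.zero_mul]

theorem lam_inv_lam (a b : B) : S.lam (S.inv a) (S.lam a b) = b := by
  rw [← lam_mul, S.inv_mul, lam_zero_left]

theorem lam_lam_inv (a b : B) : S.lam a (S.lam (S.inv a) b) = b := by
  rw [← lam_mul, S.mul_inv, lam_zero_left]

/-- `λ_a` as an endomorphism of the additive group. -/
def lamHom (a : B) : letI := S.addGroup; B →+ B :=
  letI := S.addGroup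
  AddMonoidHom.mk' (S.lam a) (S.lam_add a)

/-- The elements whose `λ`-map fixes `e` and which commute with `e` both additively and
multiplicatively. -/
def commutant (e : B) : Set B :=
  {a | S.lam a e = e ∧ S.add a e = S.add e a ∧ S.mul a e = S.mul e a}

theorem zero_mem_commutant (e : B) : S.zero ∈ S.commutant e :=
  ⟨S.lam_zero_left e, by rw [S.zero_add, S.add_zero], by rw [S.zero_mul, S.mul_zero]⟩

theorem mul_mem_commutant {e a b : B} (ha : a ∈ S.commutant e) (hb : b ∈ S.commutant e) :
    S.mul a b ∈ S.commutant e := by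
  obtain ⟨ha₁, ha₂, ha₃⟩ := ha
  obtain ⟨hb₁, hb₂, hb₃⟩ := hb
  refine ⟨by rw [lam_mul, hb₁, ha₁], ?_, ?_⟩
  · have h := congrArg (S.lam a) hb₂
    rw [lam_add, lam_add, ha₁] at h
    rw [mul_eq_add_lam, S.add_assoc, h, ← S.add_assoc, ha₂, S.add_assoc]
  · rw [S.mul_assoc, hb₃, ← S.mul_assoc, ha₃, S.mul_assoc]

theorem inv_mem_commutant {e a : B} (ha : a ∈ S.commutant e) : S.inv a ∈ S.commutant e := by
  obtain ⟨ha₁, ha₂, ha₃⟩ := ha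
  have hlam : S.lam (S.inv a) e = e := by
    conv_lhs => rw [← ha₁, lam_inv_lam]
  refine ⟨hlam, ?_, ?_⟩
  · have h := congrArg (S.lam (S.inv a)) ha₂
    rw [lam_add, lam_add, hlam] at h
    have h₀ : S.add (S.inv a) (S.lam (S.inv a) a) = S.zero := by
      rw [← mul_eq_add_lam, S.inv_mul]
    let := S.addGroup
    have h₁ : S.inv a = -S.lam (S.inv a) a := eq_neg_of_add_eq_zero_left h₀
    rw [h₁]
    exact AddCommute.neg_left (a := S.lam (S.inv a) a) (b := e) h
  · let := S.mulGroup
    exact Commute.inv_left (a := a) (b := e) ha₃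

/-- Elements related by the flip under the solution of the skew brace commute in every sense. -/
theorem mem_commutant_of_rB {e a : B} (h₁ : S.rB (e, a) = (a, e)) (h₂ : S.rB (a, e) = (e, a)) :
    a ∈ S.commutant e := by
  simp only [rB, Prod.mk.injEq] at h₁ h₂
  have hmul : S.mul a e = S.mul e a := by
    have h := h₂.2
    rw [rho, h₂.1] at h
    rw [← S.zero_mul (S.mul a e), ← S.mul_inv e, S.mul_assoc, ← S.mul_assoc (S.inv e), h]
  refine ⟨h₂.1, ?_, hmul⟩
  rwa [mul_eq_add_lam, mul_eq_add_lam, h₂.1, h₁.1] at hmul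

/-- Additive multiples and multiplicative powers of `e` agree when `λ_e` fixes `e`. -/
theorem zsmul_eq_zpow {e : B} (he : S.lam e e = e) (n : ℤ) :
    letI := S.addGroup; letI := S.mulGroup; n • e = e ^ n := by
  let := S.addGroup
  let := S.mulGroup
  have hlam (m : ℤ) : S.lam e (m • e) = m • e := by
    have h := map_zsmul (S.lamHom e) m e
    change S.lam e (m • e) = m • S.lam e e at h
    rwa [he] at h
  have hstep (m : ℤ) : (m + 1) • e = e * m • e := by
    rw [add_comm, add_zsmul, one_zsmul]
    change S.add e (m • e) = S.mul e (m • e)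
    rw [mul_eq_add_lam, hlam]
  induction n with
  | zero => rw [zero_zsmul, zpow_zero]; rfl
  | succ n ih => rw [hstep, ih, add_comm, zpow_one_add]
  | pred n ih =>
    have h := hstep (-n - 1)
    rw [sub_add_cancel, ih] at h
    rw [sub_eq_neg_add, zpow_add, zpow_neg_one, h, inv_mul_cancel_left, ← sub_eq_neg_add]

theorem mem_commutant_zsmul {e a : B} (he : S.lam e e = e) (ha : a ∈ S.commutant e) (n : ℤ) :
    letI := S.addGroup; a ∈ S.commutant (n • e) := by
  let := S.addGroup
  let := S.mulGroup
  obtain ⟨ha₁, ha₂, ha₃⟩ := ha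
  refine ⟨?_, AddCommute.zsmul_right (a := a) (b := e) ha₂ n, ?_⟩
  · have h := map_zsmul (S.lamHom a) n e
    change S.lam a (n • e) = n • S.lam a e at h
    rwa [ha₁] at h
  · rw [S.zsmul_eq_zpow he]
    exact Commute.zpow_right (a := a) (b := e) ha₃ n

theorem mulClosure_eq (A : Set B) :
    mulClosure S A = letI := S.mulGroup; (Subgroup.closure A : Set B) := by
  let := S.mulGroup
  apply Set.Subset.antisymm
  · exact Set.sInter_subset_of_mem ⟨one_mem (Subgroup.closure A),
      fun _ ha _ hb => mul_mem (S := Subgroup B) ha hb,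
      fun _ ha => inv_mem (S := Subgroup B) ha, Subgroup.subset_closure⟩
  · rintro x hx H ⟨h₀, hm, hi, hA⟩
    let K : Subgroup B :=
      { carrier := H, one_mem' := h₀, mul_mem' := fun ha hb => hm _ ha _ hb,
        inv_mem' := fun ha => hi _ ha }
    exact (Subgroup.closure_le K).2 hA hx

theorem addClosure_eq (A : Set B) :
    addClosure S A = letI := S.addGroup; (AddSubgroup.closure A : Set B) := by
  let := S.addGroup
  apply Set.Subset.antisymm
  · exact Set.sInter_subset_of_mem ⟨zero_mem (AddSubgroup.closure A),
      fun _ ha _ hb => add_mem (S := AddSubgroup B) ha hb,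
      fun _ ha => neg_mem (S := AddSubgroup B) ha, AddSubgroup.subset_closure⟩
  · rintro x hx H ⟨h₀, hm, hi, hA⟩
    let K : AddSubgroup B :=
      { carrier := H, zero_mem' := h₀, add_mem' := fun ha hb => hm _ ha _ hb,
        neg_mem' := fun ha => hi _ ha }
    exact (AddSubgroup.closure_le K).2 hA hx

end SkewBrace

section Groups

variable {G H : Type*}

/-- If `f` maps a nonempty set `A` to a single element `e`, then `⟨A⟩ · ker f` is the preimage
of `⟨e⟩`. -/
@[to_additive]
theorem MonoidHom.exists_closure_mul_ker_iff [Group G] [Group H] (f : G →* H) {A : Set G} {e : H}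
    (hne : A.Nonempty) (hA : ∀ a ∈ A, f a = e) (g : G) :
    (∃ a ∈ Subgroup.closure A, ∃ b, f b = 1 ∧ g = a * b) ↔ ∃ n : ℤ, f g = e ^ n := by
  constructor
  · rintro ⟨a, ha, b, hb, rfl⟩
    have hle : Subgroup.closure A ≤ (Subgroup.zpowers e).comap f := by
      rw [Subgroup.closure_le]
      intro x hx
      simp [hA x hx]
    obtain ⟨n, hn⟩ := Subgroup.mem_zpowers_iff.1 (hle ha)
    exact ⟨n, by rw [map_mul, hb, mul_one, hn]⟩
  · rintro ⟨n, hn⟩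
    obtain ⟨x, hx⟩ := hne
    refine ⟨x ^ n, zpow_mem (Subgroup.subset_closure hx) n, (x ^ n)⁻¹ * g, ?_, ?_⟩
    · rw [map_mul, map_inv, map_zpow, hA x hx, hn, inv_mul_cancel]
    · rw [mul_inv_cancel_left]

end Groups

section Ideals

variable {B : Type u} {C : Type v} {S : SkewBrace B} {T : SkewBrace C} {f : B → C}

/-- A skew brace homomorphism as a homomorphism of multiplicative groups. -/
def IsHom.mulHom (hf : IsHom S T f) : letI := S.mulGroup; letI := T.mulGroup; B →* C :=
  letI := S.mulGroup
  letI := T.mulGroup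
  MonoidHom.mk' f hf.2

/-- A skew brace homomorphism as a homomorphism of additive groups. -/
def IsHom.addHom (hf : IsHom S T f) : letI := S.addGroup; letI := T.addGroup; B →+ C :=
  letI := S.addGroup
  letI := T.addGroup
  AddMonoidHom.mk' f hf.1

theorem IsHom.map_zero (hf : IsHom S T f) : f S.zero = T.zero :=
  letI := S.addGroup
  letI := T.addGroup
  _root_.map_zero hf.addHom

theorem IsHom.map_neg (hf : IsHom S T f) (a : B) : f (S.neg a) = T.neg (f a) :=
  letI := S.addGroup
  letI := T.addGroup
  _root_.map_neg hf.addHom a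

theorem IsHom.map_inv (hf : IsHom S T f) (a : B) : f (S.inv a) = T.inv (f a) :=
  letI := S.mulGroup
  letI := T.mulGroup
  _root_.map_inv hf.mulHom a

theorem IsHom.map_lam (hf : IsHom S T f) (a b : B) : f (S.lam a b) = T.lam (f a) (f b) := by
  simp only [SkewBrace.lam, hf.1, hf.2, hf.map_neg]

theorem setMul_mulClosure_brKer (hf : IsHom S T f) {A : Set B} {e : C} (hne : A.Nonempty)
    (hA : ∀ a ∈ A, f a = e) :
    setMul S (mulClosure S A) (brKer T f) = {g | letI := T.mulGroup; ∃ n : ℤ, f g = e ^ n} := by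
  let := S.mulGroup
  let := T.mulGroup
  rw [S.mulClosure_eq]
  ext g
  exact hf.mulHom.exists_closure_mul_ker_iff hne hA g

theorem setAdd_addClosure_brKer (hf : IsHom S T f) {A : Set B} {e : C} (hne : A.Nonempty)
    (hA : ∀ a ∈ A, f a = e) :
    setAdd S (addClosure S A) (brKer T f) = {g | letI := T.addGroup; ∃ n : ℤ, f g = n • e} := by
  let := S.addGroup
  let := T.addGroup
  rw [S.addClosure_eq]
  ext g
  exact hf.addHom.exists_closure_add_ker_iff hne hA g

/-- If the image of `f` centralises `e`, the preimage of the multiples of `e` is an ideal. -/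
theorem isIdeal_preimage_zmultiples (hf : IsHom S T f) {e : C} (he : T.lam e e = e)
    (hc : ∀ g, f g ∈ T.commutant e) :
    IsIdeal S {g | letI := T.addGroup; ∃ n : ℤ, f g = n • e} := by
  let := T.addGroup
  let := T.mulGroup
  have hc' (g : B) (n : ℤ) := T.mem_commutant_zsmul he (hc g) n
  have hlam (b a : B) (ha : ∃ n : ℤ, f a = n • e) : ∃ n : ℤ, f (S.lam b a) = n • e := by
    obtain ⟨n, hn⟩ := ha
    exact ⟨n, by rw [hf.map_lam, hn, (hc' b n).1]⟩
  refine ⟨⟨0, ?_⟩, ?_, ?_, ?_, ?_, ?_, ?_, ?_⟩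
  · rw [hf.map_zero, zero_zsmul]; rfl
  · rintro a ⟨m, hm⟩ b ⟨n, hn⟩
    exact ⟨m + n, by rw [hf.1, hm, hn, add_zsmul]; rfl⟩
  · rintro a ⟨m, hm⟩
    exact ⟨-m, by rw [hf.map_neg, hm, neg_zsmul]; rfl⟩
  · rintro a ⟨m, hm⟩ b ⟨n, hn⟩
    refine ⟨m + n, ?_⟩
    rw [hf.2, hm, hn, T.zsmul_eq_zpow he, T.zsmul_eq_zpow he, T.zsmul_eq_zpow he, zpow_add]; rfl
  · rintro a ⟨m, hm⟩
    refine ⟨-m, ?_⟩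
    rw [hf.map_inv, hm, T.zsmul_eq_zpow he, T.zsmul_eq_zpow he, zpow_neg]; rfl
  · rintro b a ⟨n, hn⟩
    refine ⟨n, ?_⟩
    rw [hf.1, hf.1, hf.map_neg, hn, (hc' b n).2.1, T.add_assoc, T.add_neg, T.add_zero]
  · rintro b a ⟨n, hn⟩
    refine ⟨n, ?_⟩
    rw [hf.2, hf.2, hf.map_inv, hn, (hc' b n).2.2, T.mul_assoc, T.mul_inv, T.mul_zero]
  · intro b
    apply Set.Subset.antisymm
    · rintro _ ⟨a, ha, rfl⟩
      exact hlam b a ha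
    · intro a ha
      exact ⟨S.lam (S.inv b) a, hlam _ a ha, S.lam_lam_inv b a⟩

end Ideals

/-- A homomorphism of solutions with i-kernel the class of `x` sends `x` to a point that is
flipped with every point of the image. -/
theorem IsIKernel.apply_eq_swap {X : Type u} {U : Type v} {r : X × X → X × X}
    {s : U × U → U × U} {f : X → U} {x : X} (h : IsIKernel r s f (kerClass f x)) (z : X) :
    s (f x, f z) = (f z, f x) ∧ s (f z, f x) = (f x, f z) := by
  obtain ⟨hf, -, hk⟩ := h
  have h₁ : r (x, z) ∈ kerClass f z ×ˢ kerClass f x :=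
    (hk z).1 ▸ Set.mem_image_of_mem r (Set.mk_mem_prod rfl rfl)
  have h₂ : r (z, x) ∈ kerClass f x ×ˢ kerClass f z :=
    (hk z).2 ▸ Set.mem_image_of_mem r (Set.mk_mem_prod rfl rfl)
  exact ⟨(congrFun hf (x, z)).symm.trans (Prod.ext h₁.1 h₁.2),
    (congrFun hf (z, x)).symm.trans (Prod.ext h₂.1 h₂.2)⟩

/-- For an i-homomorphism of non-degenerate solutions with i-kernel
`X₀` and induced `f̄ : G_X → G_U`, the set `I = ⟨ι(X₀)⟩_· · Ker f̄` equals
`⟨ι(X₀)⟩_+ + Ker f̄`, and `I` is an ideal of `G_X`. -/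
theorem stmt_11 {X U : Type u} (r : X × X → X × X) (s : U × U → U × U)
    (hr : IsSolution r) (hrn : Nondeg r) (hs : IsSolution s) (hsn : Nondeg s)
    (f : X → U) (X₀ : Set X) (hik : IsIKernel r s f X₀)
    (GX : StructureBrace r) (GU : StructureBrace s)
    (fbar : GX.G → GU.G) (hfb : IsHom GX.S GU.S fbar)
    (hcomm : fbar ∘ GX.ι = GU.ι ∘ f) :
    setMul GX.S (mulClosure GX.S (GX.ι '' X₀)) (brKer GU.S fbar) =
      setAdd GX.S (addClosure GX.S (GX.ι '' X₀)) (brKer GU.S fbar) ∧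
    IsIdeal GX.S (setMul GX.S (mulClosure GX.S (GX.ι '' X₀)) (brKer GU.S fbar)) := by
  obtain ⟨x, rfl⟩ := hik.2.1
  set e := fbar (GX.ι x) with he
  have hι (z : X) : fbar (GX.ι z) = GU.ι (f z) := congrFun hcomm z
  have hA : ∀ a ∈ GX.ι '' kerClass f x, fbar a = e := by
    rintro _ ⟨z, hz, rfl⟩
    rw [he, hι, hι, hz]
  have hne : (GX.ι '' kerClass f x).Nonempty := ⟨_, x, rfl, rfl⟩
  have hgen (z : X) : fbar (GX.ι z) ∈ GU.S.commutant e := by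
    obtain ⟨h₁, h₂⟩ := hik.apply_eq_swap z
    rw [he, hι, hι]
    apply GU.S.mem_commutant_of_rB
    · exact (congrFun GU.compat (f x, f z)).symm.trans (congrArg (Prod.map GU.ι GU.ι) h₁)
    · exact (congrFun GU.compat (f z, f x)).symm.trans (congrArg (Prod.map GU.ι GU.ι) h₂)
  have hc (g : GX.G) : fbar g ∈ GU.S.commutant e := by
    have huniv : fbar ⁻¹' GU.S.commutant e = Set.univ := by
      apply GX.gen
      · rw [Set.mem_preimage, hfb.map_zero]
        exact GU.S.zero_mem_commutant e
      · intro a ha b hb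
        rw [Set.mem_preimage, hfb.2]
        exact GU.S.mul_mem_commutant ha hb
      · intro a ha
        rw [Set.mem_preimage, hfb.map_inv]
        exact GU.S.inv_mem_commutant ha
      · rintro _ ⟨z, rfl⟩
        exact hgen z
    exact huniv.ge (Set.mem_univ g)
  have hee : GU.S.lam e e = e := (hgen x).1
  have heq : setMul GX.S (mulClosure GX.S (GX.ι '' kerClass f x)) (brKer GU.S fbar) =
      setAdd GX.S (addClosure GX.S (GX.ι '' kerClass f x)) (brKer GU.S fbar) := by
    rw [setMul_mulClosure_brKer hfb hne hA, setAdd_addClosure_brKer hfb hne hA]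
    simp only [GU.S.zsmul_eq_zpow hee]
  refine ⟨heq, ?_⟩
  rw [heq, setAdd_addClosure_brKer hfb hne hA]
  exact isIdeal_preimage_zmultiples hfb hee hc
end

section
/- Let f : (X,r) → (U,s) be an i-homomorphism of non-degenerate solutions with i-kernel X₀ ⊆ X, let f̄ : G_X → G_U be the induced skew brace homomorphism, and let I := ⟨ι(X₀)⟩_· · Ker f̄ be the associated ideal of G_X. If the canonical map ι_U : U → G_U is injective, then for all x, y ∈ X, ι(x)·I = ι(y)·I implies f(x) = f(y). -/
/-!
Common definitions: skew braces, set-theoretic solutions of the Yang–Baxter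
equation, structure skew braces, ideals, i-homomorphisms, solubility.
-/

universe u v

/-- The multiplicative group of a skew brace. -/
abbrev SkewBrace.mulGroup_s13 {B : Type u} (S : SkewBrace B) : Group B where
  mul := S.mul
  one := S.zero
  inv := S.inv
  mul_assoc := S.mul_assoc
  one_mul := S.zero_mul
  mul_one := S.mul_zero
  inv_mul_cancel := S.inv_mul

/-- The trivial skew brace on the integers. -/
def intBrace : SkewBrace (ULift.{u} ℤ) where
  add a b := a + b
  zero := 0
  neg a := -a
  mul a b := a + b
  inv a := -a
  add_assoc := _root_.add_assoc
  zero_add := _root_.zero_add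
  add_zero := _root_.add_zero
  neg_add := neg_add_cancel
  add_neg := add_neg_cancel
  mul_assoc := _root_.add_assoc
  zero_mul := _root_.zero_add
  mul_zero := _root_.add_zero
  inv_mul := neg_add_cancel
  mul_inv := add_neg_cancel
  compat a b c := by abel

/-- The degree map: every generator `ι x` of the structure skew brace has degree one. -/
theorem StructureBrace.exists_degree {X : Type u} {r : X × X → X × X} (GX : StructureBrace r) :
    ∃ d : GX.G → ℤ, (∀ a b, d (GX.S.mul a b) = d a + d b) ∧ ∀ x, d (GX.ι x) = 1 := by
  obtain ⟨h, ⟨⟨-, hmul⟩, hι⟩, -⟩ := GX.univ intBrace.{u} (fun _ => ⟨1⟩) (by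
    funext p
    simp [SkewBrace.rB, SkewBrace.lam, SkewBrace.rho, intBrace]
    rfl)
  refine ⟨fun a => (h a).down, fun a b => ?_, fun x => ?_⟩
  · exact congrArg ULift.down (hmul a b)
  · exact congrArg ULift.down (congrFun hι x)

/-- A multiplicative map sending `A` to a single element `g` sends the multiplicative
subgroup generated by `A` to powers of `g`. -/
theorem exists_zpow_of_mem_mulClosure {B : Type u} {C : Type v} (S : SkewBrace B)
    (T : SkewBrace C) (φ : B → C) (hφ : ∀ a b, φ (S.mul a b) = T.mul (φ a) (φ b))
    {A : Set B} {g : C} (hA : ∀ a ∈ A, φ a = g) {a : B} (ha : a ∈ mulClosure S A) :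
    ∃ n : ℤ, φ a = letI := T.mulGroup_s13; g ^ n := by
  let := S.mulGroup_s13
  let := T.mulGroup_s13
  let ψ : B →* C := MonoidHom.mk' φ hφ
  have hmem : a ∈ (Subgroup.zpowers g).comap ψ :=
    ha ((Subgroup.zpowers g).comap ψ : Subgroup B)
      ⟨one_mem _, fun _ hx _ hy => mul_mem hx hy, fun _ hx => inv_mem hx, fun b hb => by
        change φ b ∈ Subgroup.zpowers g
        rw [hA b hb]
        exact Subgroup.mem_zpowers g⟩
  obtain ⟨n, hn⟩ := Subgroup.mem_zpowers_iff.mp hmem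
  exact ⟨n, hn.symm⟩

/-- With `I = ⟨ι(X₀)⟩_· · Ker f̄` the associated ideal of `G_X`, if
the canonical map `ι_U : U → G_U` is injective, then `ι(x)·I = ι(y)·I` implies
`f(x) = f(y)`. -/
theorem stmt_13 {X U : Type u} (r : X × X → X × X) (s : U × U → U × U)
    (hr : IsSolution r) (hrn : Nondeg r) (hs : IsSolution s) (hsn : Nondeg s)
    (f : X → U) (X₀ : Set X) (hik : IsIKernel r s f X₀)
    (GX : StructureBrace r) (GU : StructureBrace s)
    (fbar : GX.G → GU.G) (hfb : IsHom GX.S GU.S fbar)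
    (hcomm : fbar ∘ GX.ι = GU.ι ∘ f)
    (hinjU : Function.Injective GU.ι) :
    ∀ x y : X,
      lCoset GX.S (GX.ι x) (setMul GX.S (mulClosure GX.S (GX.ι '' X₀)) (brKer GU.S fbar)) =
      lCoset GX.S (GX.ι y) (setMul GX.S (mulClosure GX.S (GX.ι '' X₀)) (brKer GU.S fbar)) →
      f x = f y := by
  intro x y hxy
  let := GX.S.mulGroup_s13
  let := GU.S.mulGroup_s13
  obtain ⟨-, ⟨x₀, rfl⟩, -⟩ := hik
  have hι : ∀ z, fbar (GX.ι z) = GU.ι (f z) := congrFun hcomm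
  let ψ : GX.G →* GU.G := MonoidHom.mk' fbar hfb.2
  have hmem : GX.ι x ∈ lCoset GX.S (GX.ι x)
      (setMul GX.S (mulClosure GX.S (GX.ι '' kerClass f x₀)) (brKer GU.S fbar)) :=
    ⟨1, ⟨1, fun _ hH => hH.1, 1, map_one ψ, (mul_one (1 : GX.G)).symm⟩, mul_one _⟩
  rw [hxy] at hmem
  obtain ⟨_, ⟨a, ha, k, hk, rfl⟩, hx⟩ := hmem
  obtain ⟨n, hn⟩ := exists_zpow_of_mem_mulClosure GX.S GU.S fbar hfb.2 (g := GU.ι (f x₀))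
    (by rintro _ ⟨z, hz, rfl⟩; rw [hι, show f z = f x₀ from hz]) ha
  have key : GU.ι (f x) = GU.ι (f y) * GU.ι (f x₀) ^ n := by
    have h : ψ (GX.ι y * (a * k)) = ψ (GX.ι x) := congrArg ψ hx
    rw [map_mul, map_mul, show ψ k = 1 from hk, mul_one, show ψ a = _ from hn,
      show ψ (GX.ι x) = _ from hι x, show ψ (GX.ι y) = _ from hι y] at h
    exact h.symm
  obtain ⟨d, hd, hd1⟩ := GU.exists_degree
  let δ : GU.G →* Multiplicative ℤ := MonoidHom.mk' (fun c => Multiplicative.ofAdd (d c))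
    fun a b => congrArg Multiplicative.ofAdd (hd a b)
  have hδ : ∀ u, δ (GU.ι u) = Multiplicative.ofAdd 1 := fun u =>
    congrArg Multiplicative.ofAdd (hd1 u)
  have hn0 : n = 0 := by
    have h := congrArg δ key
    rw [map_mul, map_zpow, hδ, hδ, hδ, left_eq_mul, ← ofAdd_zsmul, ofAdd_eq_one] at h
    simpa using h
  rw [hn0, zpow_zero, mul_one] at key
  exact hinjU key
end

section
/- Let B be a skew brace with an ideal J, let f : B → B/J be the canonical epimorphism, and let f̄ : G_B → G_{B/J} be the induced skew brace homomorphism between the structure skew braces of (B, r_B) and (B/J, r_{B/J}). Then I_J^f := ⟨ι(J)⟩_· · Ker f̄ (where ⟨ι(J)⟩_· is the multiplicative subgroup of G_B generated by ι(J)) is an ideal of G_B, and for all b₁, b₂ ∈ B one has ι(b₁)·I_J^f = ι(b₂)·I_J^f if and only if b₁·J = b₂·J. -/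
/-!
Common definitions: skew braces, set-theoretic solutions of the Yang–Baxter
equation, structure skew braces, ideals, i-homomorphisms, solubility.
-/

universe u v

namespace SkewBrace

variable {B : Type u} (S : SkewBrace B)

theorem mul_inv_cancel_left (a b : B) : S.mul a (S.mul (S.inv a) b) = b := by
  rw [← S.mul_assoc, S.mul_inv, S.zero_mul]

theorem inv_mul_cancel_left (a b : B) : S.mul (S.inv a) (S.mul a b) = b := by
  rw [← S.mul_assoc, S.inv_mul, S.zero_mul]

theorem add_neg_cancel_left (a b : B) : S.add a (S.add (S.neg a) b) = b := by
  rw [← S.add_assoc, S.add_neg, S.zero_add]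

theorem neg_add_cancel_left (a b : B) : S.add (S.neg a) (S.add a b) = b := by
  rw [← S.add_assoc, S.neg_add, S.zero_add]

theorem mul_left_cancel {a b c : B} (h : S.mul a b = S.mul a c) : b = c := by
  rw [← S.inv_mul_cancel_left a b, h, S.inv_mul_cancel_left]

theorem inv_zero : S.inv S.zero = S.zero := by
  rw [← S.mul_zero (S.inv S.zero), S.inv_mul]

theorem neg_zero : S.neg S.zero = S.zero := by
  rw [← S.add_zero (S.neg S.zero), S.neg_add]

theorem add_lam (a b : B) : S.add a (S.lam a b) = S.mul a b :=
  S.add_neg_cancel_left a _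

theorem lam_mul_rho (a b : B) : S.mul (S.lam a b) (S.rho b a) = S.mul a b := by
  rw [rho, S.mul_assoc, S.mul_inv_cancel_left]

theorem lam_zero_right (a : B) : S.lam a S.zero = S.zero := by
  rw [lam, S.mul_zero, S.neg_add]

theorem rho_zero_right (b : B) : S.rho b S.zero = S.zero := by
  rw [rho, S.lam_zero_left, S.mul_zero, S.inv_mul]

/-- Two elements for which all four sums and products coincide. -/
def Annihilates (z g : B) : Prop :=
  S.mul z g = S.mul g z ∧ S.add z g = S.mul z g ∧ S.add g z = S.mul z g

variable {S}

theorem Annihilates.symm {z g : B} (h : S.Annihilates z g) : S.Annihilates g z :=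
  ⟨h.1.symm, h.2.2.trans h.1, h.2.1.trans h.1⟩

theorem annihilates_zero (z : B) : S.Annihilates z S.zero := by
  simp [Annihilates, S.mul_zero, S.zero_mul, S.add_zero, S.zero_add]

theorem Annihilates.mul {z a b : B} (ha : S.Annihilates z a) (hb : S.Annihilates z b) :
    S.Annihilates z (S.mul a b) := by
  obtain ⟨ha1, ha2, ha3⟩ := ha
  obtain ⟨hb1, hb2, hb3⟩ := hb
  have key : S.mul z (S.mul a b) = S.mul a (S.mul z b) := by
    rw [← S.mul_assoc, ha1, S.mul_assoc]
  refine ⟨by rw [key, hb1, S.mul_assoc], ?_, ?_⟩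
  · rw [key, ← hb2, S.compat, ← ha1, ← ha2, S.add_assoc z a, S.add_neg, S.add_zero]
  · rw [key, ← hb3, S.compat, ← ha1, ← ha3, S.add_assoc, S.neg_add_cancel_left]

theorem Annihilates.inv {z a : B} (ha : S.Annihilates z a) : S.Annihilates z (S.inv a) := by
  obtain ⟨ha1, ha2, ha3⟩ := ha
  have comm : S.mul z (S.inv a) = S.mul (S.inv a) z := by
    apply S.mul_left_cancel (a := a)
    rw [S.mul_inv_cancel_left, ← S.mul_assoc, ← ha1, S.mul_assoc, S.mul_inv, S.mul_zero]
  refine ⟨comm, ?_, ?_⟩ <;> rw [comm] <;> apply S.mul_left_cancel (a := a) <;>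
    rw [S.mul_inv_cancel_left, S.compat, S.mul_inv, ← ha1]
  · rw [← ha2, S.add_zero, S.add_assoc, S.add_neg, S.add_zero]
  · rw [← ha3, S.zero_add, S.neg_add_cancel_left]

end SkewBrace

section Closure

variable {B : Type u} (S : SkewBrace B) (A : Set B)

theorem zero_mem_mulClosure : S.zero ∈ mulClosure S A :=
  Set.mem_sInter.2 fun _ hH => hH.1

theorem mul_mem_mulClosure {a b : B} (ha : a ∈ mulClosure S A) (hb : b ∈ mulClosure S A) :
    S.mul a b ∈ mulClosure S A :=
  Set.mem_sInter.2 fun H hH =>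
    hH.2.1 a (Set.mem_sInter.1 ha H hH) b (Set.mem_sInter.1 hb H hH)

theorem inv_mem_mulClosure {a : B} (ha : a ∈ mulClosure S A) : S.inv a ∈ mulClosure S A :=
  Set.mem_sInter.2 fun H hH => hH.2.2.1 a (Set.mem_sInter.1 ha H hH)

theorem subset_mulClosure : A ⊆ mulClosure S A :=
  fun _ ha => Set.mem_sInter.2 fun _ hH => hH.2.2.2 ha

theorem mulClosure_subset {H : Set B} (h0 : S.zero ∈ H)
    (hmul : ∀ a ∈ H, ∀ b ∈ H, S.mul a b ∈ H) (hinv : ∀ a ∈ H, S.inv a ∈ H) (hA : A ⊆ H) :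
    mulClosure S A ⊆ H :=
  Set.sInter_subset_of_mem ⟨h0, hmul, hinv, hA⟩

/-- A multiplicative subgroup generated by elements of the annihilator is an ideal. -/
theorem isIdeal_mulClosure_of_annihilates (hA : ∀ z ∈ A, ∀ g, S.Annihilates z g) :
    IsIdeal S (mulClosure S A) := by
  have ann : ∀ k ∈ mulClosure S A, ∀ g, S.Annihilates k g :=
    mulClosure_subset (H := {k | ∀ g, S.Annihilates k g}) S A
      (fun g => (SkewBrace.annihilates_zero g).symm)
      (fun a ha b hb g => ((ha g).symm.mul (hb g).symm).symm)
      (fun a ha g => (ha g).symm.inv.symm) hA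
  have hlam : ∀ g, ∀ k ∈ mulClosure S A, S.lam g k = k := fun g k hk => by
    rw [SkewBrace.lam, ← (ann k hk g).1, ← (ann k hk g).2.2, S.neg_add_cancel_left]
  refine ⟨zero_mem_mulClosure S A, fun a ha b hb => ?_, fun a ha => ?_,
    fun a ha b hb => mul_mem_mulClosure S A ha hb, fun a ha => inv_mem_mulClosure S A ha,
    fun b a ha => ?_, fun b a ha => ?_, fun b => ?_⟩
  · rw [(ann a ha b).2.1]
    exact mul_mem_mulClosure S A ha hb
  · have : S.neg a = S.inv a := by
      apply S.add_left_cancel (a := a)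
      rw [S.add_neg, (ann a ha _).2.1, S.mul_inv]
    rw [this]
    exact inv_mem_mulClosure S A ha
  · rwa [(ann a ha b).2.2, ← (ann a ha b).2.1, S.add_assoc, S.add_neg, S.add_zero]
  · rwa [← (ann a ha b).1, S.mul_assoc, S.mul_inv, S.mul_zero]
  · exact (Set.image_congr (hlam b)).trans (Set.image_id' _)

end Closure

namespace IsHom

variable {B : Type u} {C : Type v} {S : SkewBrace B} {T : SkewBrace C} {f : B → C}

theorem map_zero_s14 (hf : IsHom S T f) : f S.zero = T.zero := by
  apply T.mul_left_cancel (a := f S.zero)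
  rw [← hf.2, S.mul_zero, T.mul_zero]

theorem map_inv_s14 (hf : IsHom S T f) (a : B) : f (S.inv a) = T.inv (f a) := by
  apply T.mul_left_cancel (a := f a)
  rw [← hf.2, S.mul_inv, T.mul_inv, hf.map_zero_s14]

theorem map_neg_s14 (hf : IsHom S T f) (a : B) : f (S.neg a) = T.neg (f a) := by
  apply T.add_left_cancel (a := f a)
  rw [← hf.1, S.add_neg, T.add_neg, hf.map_zero_s14]

theorem map_lam_s14 (hf : IsHom S T f) (a b : B) : f (S.lam a b) = T.lam (f a) (f b) := by
  rw [SkewBrace.lam, hf.1, hf.map_neg_s14, hf.2, SkewBrace.lam]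

theorem preimage_isIdeal (hf : IsHom S T f) {K : Set C} (hK : IsIdeal T K) :
    IsIdeal S (f ⁻¹' K) := by
  obtain ⟨h0, hadd, hneg, hmul, hinv, hna, hnm, hlam⟩ := hK
  have hl : ∀ b, ∀ a ∈ f ⁻¹' K, S.lam b a ∈ f ⁻¹' K := fun b a ha => by
    rw [Set.mem_preimage, hf.map_lam_s14, ← hlam (f b)]
    exact ⟨_, ha, rfl⟩
  refine ⟨?_, fun a ha b hb => ?_, fun a ha => ?_, fun a ha b hb => ?_, fun a ha => ?_,
    fun b a ha => ?_, fun b a ha => ?_, fun b => ?_⟩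
  · rwa [Set.mem_preimage, hf.map_zero_s14]
  · rw [Set.mem_preimage, hf.1]
    exact hadd _ ha _ hb
  · rw [Set.mem_preimage, hf.map_neg_s14]
    exact hneg _ ha
  · rw [Set.mem_preimage, hf.2]
    exact hmul _ ha _ hb
  · rw [Set.mem_preimage, hf.map_inv_s14]
    exact hinv _ ha
  · rw [Set.mem_preimage, hf.1, hf.1, hf.map_neg_s14]
    exact hna _ _ ha
  · rw [Set.mem_preimage, hf.2, hf.2, hf.map_inv_s14]
    exact hnm _ _ ha
  · apply Set.Subset.antisymm
    · rintro _ ⟨a, ha, rfl⟩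
      exact hl b a ha
    · exact fun a ha => ⟨_, hl (S.inv b) a ha, S.lam_lam_inv b a⟩

/-- The product of the subgroup generated by `A` with the kernel is the preimage of the
subgroup generated by the image of `A`. -/
theorem setMul_mulClosure_brKer (hf : IsHom S T f) (A : Set B) :
    setMul S (mulClosure S A) (brKer T f) = f ⁻¹' mulClosure T (f '' A) := by
  apply Set.Subset.antisymm
  · rintro _ ⟨a, ha, b, hb, rfl⟩
    have hb' : f b = T.zero := hb
    rw [Set.mem_preimage, hf.2, hb', T.mul_zero]
    refine mulClosure_subset (H := f ⁻¹' mulClosure T (f '' A)) S A ?_ (fun a ha b hb => ?_)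
      (fun a ha => ?_) (fun a ha => subset_mulClosure _ _ ⟨a, ha, rfl⟩) ha
    · rw [Set.mem_preimage, hf.map_zero_s14]
      exact zero_mem_mulClosure _ _
    · rw [Set.mem_preimage, hf.2]
      exact mul_mem_mulClosure _ _ ha hb
    · rw [Set.mem_preimage, hf.map_inv_s14]
      exact inv_mem_mulClosure _ _ ha
  · intro g hg
    obtain ⟨a, ha, hag⟩ : f g ∈ f '' mulClosure S A := by
      refine mulClosure_subset (H := f '' mulClosure S A) T _
        ⟨_, zero_mem_mulClosure S A, hf.map_zero_s14⟩ ?_ ?_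
        (Set.image_mono (subset_mulClosure S A)) hg
      · rintro _ ⟨a, ha, rfl⟩ _ ⟨b, hb, rfl⟩
        exact ⟨_, mul_mem_mulClosure S A ha hb, hf.2 a b⟩
      · rintro _ ⟨a, ha, rfl⟩
        exact ⟨_, inv_mem_mulClosure S A ha, hf.map_inv_s14 a⟩
    refine ⟨a, ha, S.mul (S.inv a) g, ?_, (S.mul_inv_cancel_left a g).symm⟩
    change f _ = _
    rw [hf.2, hf.map_inv_s14, hag, T.inv_mul]

end IsHom

theorem IsIdeal.lCoset_eq_iff {B : Type u} {S : SkewBrace B} {I : Set B} (hI : IsIdeal S I)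
    (a b : B) : lCoset S a I = lCoset S b I ↔ S.mul (S.inv a) b ∈ I := by
  obtain ⟨h0, -, -, hmul, hinv, -⟩ := hI
  constructor
  · intro h
    have hb : b ∈ lCoset S b I := ⟨_, h0, S.mul_zero b⟩
    rw [← h] at hb
    obtain ⟨w, hw, hwb⟩ := hb
    rw [← hwb]
    simpa [S.inv_mul_cancel_left] using hw
  · intro h
    have hb : b = S.mul a (S.mul (S.inv a) b) := (S.mul_inv_cancel_left a b).symm
    generalize S.mul (S.inv a) b = c at h hb
    subst hb
    apply Set.Subset.antisymm
    · rintro _ ⟨w, hw, rfl⟩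
      exact ⟨S.mul (S.inv c) w, hmul _ (hinv _ h) _ hw, by
        simp only [S.mul_assoc, S.mul_inv_cancel_left]⟩
    · rintro _ ⟨w, hw, rfl⟩
      exact ⟨S.mul c w, hmul _ h _ hw, (S.mul_assoc _ _ _).symm⟩

namespace StructureBrace

variable {B : Type u} {S : SkewBrace B} (G : StructureBrace S.rB)

theorem ι_lam (a b : B) : G.ι (S.lam a b) = G.S.lam (G.ι a) (G.ι b) :=
  congrArg Prod.fst (congrFun G.compat (a, b))

theorem ι_rho (a b : B) : G.ι (S.rho b a) = G.S.rho (G.ι b) (G.ι a) :=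
  congrArg Prod.snd (congrFun G.compat (a, b))

/-- The image of zero lies in the annihilator of the structure skew brace. -/
theorem annihilates_ι_zero (g : G.G) : G.S.Annihilates (G.ι S.zero) g := by
  have h : {g | G.S.Annihilates (G.ι S.zero) g} = Set.univ := by
    refine G.gen _ (SkewBrace.annihilates_zero _) (fun a ha b hb => ha.mul hb)
      (fun a ha => ha.inv) ?_
    rintro _ ⟨b, rfl⟩
    have comm : G.S.mul (G.ι S.zero) (G.ι b) = G.S.mul (G.ι b) (G.ι S.zero) := by
      rw [← G.S.lam_mul_rho, ← G.ι_lam, ← G.ι_rho, S.lam_zero_left, S.rho_zero_right]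
    refine ⟨comm, ?_, ?_⟩
    · rw [← G.S.add_lam, ← G.ι_lam, S.lam_zero_left]
    · rw [comm, ← G.S.add_lam, ← G.ι_lam, S.lam_zero_right]
  exact Set.eq_univ_iff_forall.1 h g

/-- The retraction onto the skew brace provided by the universal property. -/
theorem exists_retraction : ∃ h : G.G → B, IsHom G.S S h ∧ ∀ b, h (G.ι b) = b := by
  obtain ⟨h, ⟨hh, hι⟩, -⟩ := G.univ S id rfl
  exact ⟨h, hh, congrFun hι⟩

end StructureBrace

/-- Let `J` be an ideal of a skew brace `B`, `f : B → B/J` the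
canonical epimorphism (a surjective homomorphism with kernel `J`), and
`f̄ : G_B → G_{B/J}` the induced homomorphism. Then
`I_J^f = ⟨ι(J)⟩_· · Ker f̄` is an ideal of `G_B`, and
`ι(b₁)·I_J^f = ι(b₂)·I_J^f ↔ b₁·J = b₂·J`. -/
theorem stmt_14 {B : Type u} (S : SkewBrace B) (J : Set B) (hJ : IsIdeal S J)
    {Q : Type u} (TQ : SkewBrace Q) (f : B → Q) (hf : IsHom S TQ f)
    (hfs : Function.Surjective f) (hker : brKer TQ f = J)
    (GB : StructureBrace S.rB) (GQ : StructureBrace TQ.rB)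
    (fbar : GB.G → GQ.G) (hfb : IsHom GB.S GQ.S fbar)
    (hcomm : fbar ∘ GB.ι = GQ.ι ∘ f) :
    IsIdeal GB.S (setMul GB.S (mulClosure GB.S (GB.ι '' J)) (brKer GQ.S fbar)) ∧
    ∀ b₁ b₂ : B,
      lCoset GB.S (GB.ι b₁) (setMul GB.S (mulClosure GB.S (GB.ι '' J)) (brKer GQ.S fbar)) =
        lCoset GB.S (GB.ι b₂) (setMul GB.S (mulClosure GB.S (GB.ι '' J)) (brKer GQ.S fbar)) ↔
      lCoset S b₁ J = lCoset S b₂ J := by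
  have hA : fbar '' (GB.ι '' J) = {GQ.ι TQ.zero} := by
    ext x
    constructor
    · rintro ⟨_, ⟨j, hj, rfl⟩, rfl⟩
      have hj' : f j = TQ.zero := by rwa [← hker] at hj
      exact (congrFun hcomm j).trans (congrArg GQ.ι hj')
    · rintro rfl
      exact ⟨_, ⟨_, hJ.1, rfl⟩, (congrFun hcomm S.zero).trans (congrArg GQ.ι hf.map_zero_s14)⟩
  rw [hfb.setMul_mulClosure_brKer, hA]
  have hI := hfb.preimage_isIdeal
    (isIdeal_mulClosure_of_annihilates GQ.S {GQ.ι TQ.zero}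
      (by rintro _ rfl; exact GQ.annihilates_ι_zero))
  refine ⟨hI, fun b₁ b₂ => ?_⟩
  have hι : ∀ b, fbar (GB.ι b) = GQ.ι (f b) := congrFun hcomm
  rw [hI.lCoset_eq_iff, hJ.lCoset_eq_iff, Set.mem_preimage, hfb.2, hfb.map_inv_s14, hι, hι, ← hker]
  change _ ↔ f _ = TQ.zero
  rw [hf.2, hf.map_inv_s14]
  constructor
  · intro h
    obtain ⟨p, hp, hpι⟩ := GQ.exists_retraction
    have hK : mulClosure GQ.S {GQ.ι TQ.zero} ⊆ brKer TQ p := by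
      refine mulClosure_subset _ _ hp.map_zero_s14 (fun a ha b hb => ?_) (fun a ha => ?_) ?_
      · change p a = _ at ha
        change p b = _ at hb
        change p _ = _
        rw [hp.2, ha, hb, TQ.mul_zero]
      · change p a = _ at ha
        change p _ = _
        rw [hp.map_inv_s14, ha, TQ.inv_zero]
      · rintro _ rfl
        exact hpι TQ.zero
    have := hK h
    change p _ = TQ.zero at this
    rwa [hp.2, hp.map_inv_s14, hpι, hpι] at this
  · intro h
    have hb : f b₁ = f b₂ := by
      rw [← TQ.mul_inv_cancel_left (f b₁) (f b₂), h, TQ.mul_zero]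
    rw [hb, GQ.S.inv_mul]
    exact zero_mem_mulClosure _ _
end
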